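/- Let n ≥ 3 and let W = K1 * C_n be the wheel graph on n + 1 vertices. Then the Ehrhart counting function of the symmetric edge polytope P_W ⊆ ℝ^{n+1} satisfies lim_{m→∞} #(m·P_W ∩ ℤ^{n+1}) / m^{n} = ((1−√3)^n + (1+√3)^n − 1 − (−1)^n) / n!. (Equivalently, the normalized volume of P_W equals (1−√3)^n + (1+√3)^n when n is odd, and (1−√3)^n + (1+√3)^n − 2 when n is even.) -/

import Mathlib

open SimpleGraph Pointwise

/-- The wheel graph `K1 * C_n`: vertices are `ℤ/nℤ` (outer cycle) plus a cone vertex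
`none`; edges are the outer edges `{some i, some (i+1)}` and the spokes
`{none, some i}`. -/
def wheelGraph (n : ℕ) : SimpleGraph (Option (ZMod n)) :=
  SimpleGraph.fromRel (fun u v =>
    (u = none ∧ v ≠ none) ∨ ∃ i : ZMod n, u = some i ∧ v = some (i + 1))

/-- The symmetric edge polytope of a graph `G`. -/
def symEdgePolytope {V : Type*} [DecidableEq V] (G : SimpleGraph V) : Set (V → ℝ) :=
  convexHull ℝ {x | ∃ v w, G.Adj v w ∧ x = Pi.single v (1 : ℝ) - Pi.single w 1}

/-- The number of lattice points in the `m`-th dilate of `P ⊆ ℝ^V`. -/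
noncomputable def latticePointCount {V : Type*} (P : Set (V → ℝ)) (m : ℕ) : ℕ :=
  Nat.card {x : V → ℝ // x ∈ (m : ℝ) • P ∧ ∀ v, ∃ z : ℤ, x v = z}

/-- monotone systems have solutions -/
lemma exists_fix {ι : Type*} (σ : ι → ι) (F : ι → ℤ → ℤ) (hF : ∀ i, Monotone (F i))
    (lo hi : ι → ℤ) (h1 : ∀ i h, lo i ≤ F i h) (h2 : ∀ i h, F i h ≤ hi i) :
    ∃ g : ι → ℤ, ∀ i, g i = F i (g (σ i)) := by
  have hle : lo ≤ hi := fun i => (h1 i 0).trans (h2 i 0)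
  have : Fact (lo ≤ hi) := ⟨hle⟩
  let T : Set.Icc lo hi →o Set.Icc lo hi :=
    { toFun := fun g => ⟨fun i => F i (g.1 (σ i)), fun i => h1 i _, fun i => h2 i _⟩
      monotone' := fun a b hab i => hF i (hab (σ i)) }
  refine ⟨(OrderHom.lfp T).1, fun i => ?_⟩
  have := congrArg Subtype.val (OrderHom.map_lfp T)
  exact (congrFun this i).symm

/-- local condition on sign patterns -/
def RR (p q : SignType × SignType) : Prop :=
  ¬ (p.1 = 1 ∧ p.2 = -1) ∧ ¬ (p.1 = -1 ∧ p.2 = 1) ∧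
  ((p.1 = 1 ∨ p.2 = -1) → q.1 ≤ 0 ∧ q.2 ≤ 0) ∧
  ((p.1 = -1 ∨ p.2 = 1) → 0 ≤ q.1 ∧ 0 ≤ q.2)

instance : DecidableRel RR := fun p q => by unfold RR; infer_instance

lemma RR_iff (a b c d : ℤ) : RR (SignType.sign a, SignType.sign b) (SignType.sign c, SignType.sign d) ↔
    (¬ (0 < a ∧ b < 0) ∧ ¬ (a < 0 ∧ 0 < b) ∧ ((0 < a ∨ b < 0) → c ≤ 0 ∧ d ≤ 0) ∧
      ((a < 0 ∨ 0 < b) → 0 ≤ c ∧ 0 ≤ d)) := by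
  simp only [RR, sign_eq_one_iff, sign_eq_neg_one_iff, sign_nonpos_iff, sign_nonneg_iff]

section canon
variable {n : ℕ}

/-- boundary of a flow -/
def bd (f s : ZMod n → ℤ) : ZMod n → ℤ := fun i => s i + f i - f (i - 1)

/-- canonical flows -/
def Canon (f s : ZMod n → ℤ) : Prop :=
  ∀ i, RR (SignType.sign (f i), SignType.sign (s i))
    (SignType.sign (f (i + 1)), SignType.sign (s (i + 1)))

lemma exists_canon0 (x : ZMod n → ℤ) : ∃ f s : ZMod n → ℤ, bd f s = x ∧ Canon f s := by
  obtain ⟨f, hf⟩ := exists_fix (fun i : ZMod n => i - 1)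
    (fun i h => max (min 0 (-x (i+1))) (min (x i + h) (max 0 (-x (i+1)))))
    (fun i a b hab => by dsimp only; omega)
    (fun i => min 0 (-x (i+1))) (fun i => max 0 (-x (i+1)))
    (fun i h => by omega) (fun i h => by omega)
  refine ⟨f, fun i => x i + f (i - 1) - f i, ?_, ?_⟩
  · funext i; simp only [bd]; ring
  · intro i
    rw [RR_iff]
    have h1 := hf i
    have h2 := hf (i + 1)
    simp only [add_sub_cancel_right] at h1 h2 ⊢
    omega

lemma exists_canon [NeZero n] (x : ZMod n → ℤ) :
    ∃ f s : ZMod n → ℤ, bd f s = x ∧ Canon f s ∧ ∃ i, f i = 0 ∨ s i ≠ 0 := by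
  obtain ⟨f, s, hx, hc⟩ := exists_canon0 x
  by_cases hD : ∃ i, f i = 0 ∨ s i ≠ 0
  · exact ⟨f, s, hx, hc, hD⟩
  push Not at hD
  have hc' : ∀ i, _ := fun i => (RR_iff _ _ _ _).1 (hc i)
  have hpos : ∃ i, 0 < f i := by
    have h0 := hc' 0
    have h1 := hD 0
    have h2 := hD (0 + 1)
    by_cases h : 0 < f 0
    · exact ⟨0, h⟩
    · exact ⟨0 + 1, by omega⟩
  have hne : (Finset.univ.filter fun i => 0 < f i).Nonempty := by
    obtain ⟨i, hi⟩ := hpos; exact ⟨i, by simpa using hi⟩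
  obtain ⟨j, hj, hmin⟩ := Finset.exists_min_image _ f hne
  simp only [Finset.mem_filter, Finset.mem_univ, true_and] at hj hmin
  refine ⟨fun i => f i - f j, s, ?_, ?_, j, Or.inl (by ring)⟩
  · rw [← hx]; funext i; simp only [bd]; ring
  · intro i
    rw [RR_iff]
    have a1 := hc' i
    have a2 := hD i
    have a3 := hD (i + 1)
    have a4 := hmin i
    have a5 := hmin (i + 1)
    beta_reduce
    omega

lemma canon_inj [NeZero n] (f s f' s' : ZMod n → ℤ) (h : Canon f s) (h' : Canon f' s')
    (hb : bd f s = bd f' s') (hs : ∃ i, s i ≠ 0) : f = f' ∧ s = s' := by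
  have hc : ∀ i, _ := fun i => (RR_iff _ _ _ _).1 (h i)
  have hc' : ∀ i, _ := fun i => (RR_iff _ _ _ _).1 (h' i)
  have hbi : ∀ i, s i + f i - f (i - 1) = s' i + f' i - f' (i - 1) := fun i => congrFun hb i
  have key : ∀ i, (f i - f' i).natAbs ≤ (f (i - 1) - f' (i - 1)).natAbs := by
    intro i
    have a1 := hc i
    have a2 := hc' i
    have a3 := hbi i
    have a4 := hbi (i + 1)
    simp only [add_sub_cancel_right] at a4
    omega
  have hsum : ∑ i, (f (i - 1) - f' (i - 1)).natAbs = ∑ i, (f i - f' i).natAbs :=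
    Equiv.sum_comp (Equiv.subRight (1 : ZMod n)) (fun i => (f i - f' i).natAbs)
  have heq := (Finset.sum_eq_sum_iff_of_le (fun i _ => key i)).1 hsum.symm
  obtain ⟨j, hj⟩ := hs
  have hj0 : f j = f' j := by
    have a1 := hc j
    have a2 := hc' j
    have a3 := hbi j
    have a4 := hbi (j + 1)
    have a5 := heq j (Finset.mem_univ _)
    simp only [add_sub_cancel_right] at a4
    omega
  have hall : ∀ k : ℕ, f (j + k) = f' (j + k) := by
    intro k
    induction k with
    | zero => simpa using hj0
    | succ k ih =>
      have := key (j + (k + 1 : ℕ))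
      have e : j + ((k + 1 : ℕ) : ZMod n) - 1 = j + k := by push_cast; ring
      rw [e] at this
      omega
  have hf : f = f' := by
    funext i
    have := hall (i - j).val
    simpa using this
  refine ⟨hf, ?_⟩
  funext i
  have := hbi i
  rw [hf] at this
  omega

lemma canon_dual [NeZero n] (f s : ZMod n → ℤ) (h : Canon f s) :
    ∃ g : ZMod n → ℤ, (∀ i, |g i| ≤ 1) ∧ (∀ i, |g i - g (i + 1)| ≤ 1) ∧
      ∑ i, g i * bd f s i = ∑ i, |f i| + ∑ i, |s i| := by
  have hc : ∀ i, _ := fun i => (RR_iff _ _ _ _).1 (h i)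
  obtain ⟨g, hg⟩ := exists_fix (fun i : ZMod n => i + 1)
    (fun i h => if 0 < s i then 1 else if s i < 0 then -1 else if 0 < f i then min 1 (max (-1) (h + 1))
      else if f i < 0 then min 1 (max (-1) (h - 1)) else 0)
    (fun i a b hab => by dsimp only; split_ifs <;> omega)
    (fun i => -1) (fun i => 1)
    (fun i h => by split_ifs <;> omega) (fun i h => by split_ifs <;> omega)
  have hg1 : ∀ i, -1 ≤ g i ∧ g i ≤ 1 := by
    intro i; rw [hg]; split_ifs <;> omega
  have main : ∀ i, -1 ≤ g i - g (i + 1) ∧ g i - g (i + 1) ≤ 1 ∧ (0 < f i → g i - g (i + 1) = 1) ∧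
      (f i < 0 → g i - g (i + 1) = -1) ∧ (0 < s i → g i = 1) ∧ (s i < 0 → g i = -1) := by
    intro i
    have a1 := hc i
    have a2 := hc (i + 1)
    have b1 := hg i
    have b2 := hg (i + 1)
    have b3 := hg1 (i + 1)
    have b4 := hg1 (i + 1 + 1)
    split_ifs at b1 b2 <;> omega
  refine ⟨g, fun i => abs_le.2 (hg1 i), fun i => abs_le.2 ⟨(main i).1, (main i).2.1⟩, ?_⟩
  have e1 : ∑ i, g i * f (i - 1) = ∑ i, g (i + 1) * f i := by
    rw [← Equiv.sum_comp (Equiv.addRight (1 : ZMod n)) (fun i => g i * f (i - 1))]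
    simp
  have e2 : ∀ i, g i * s i = |s i| := by
    intro i
    obtain ⟨_, _, _, _, h1, h2⟩ := main i
    rcases lt_trichotomy (s i) 0 with hs | hs | hs
    · rw [h2 hs, abs_of_neg hs]; ring
    · simp [hs]
    · rw [h1 hs, abs_of_pos hs]; ring
  have e3 : ∀ i, g i * f i - g (i + 1) * f i = |f i| := by
    intro i
    rw [← sub_mul]
    obtain ⟨_, _, h1, h2, _, _⟩ := main i
    rcases lt_trichotomy (f i) 0 with hs | hs | hs
    · rw [h2 hs, abs_of_neg hs]; ring
    · simp [hs]
    · rw [h1 hs, abs_of_pos hs]; ring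
  simp only [bd, mul_sub, mul_add, Finset.sum_sub_distrib, Finset.sum_add_distrib, e1]
  simp only [← e2, ← e3, Finset.sum_sub_distrib]
  ring

end canon
section poly
variable {n : ℕ}

/-- lift -/
def lft [NeZero n] (x : ZMod n → ℤ) : Option (ZMod n) → ℝ
  | none => - ∑ i, (x i : ℝ)
  | some i => x i

lemma lft_inj [NeZero n] : Function.Injective (lft (n := n)) := by
  intro x y h
  funext i
  have := congrFun h (some i)
  simpa [lft] using this

lemma wheel_adj (hn : 3 ≤ n) (i : ZMod n) : (wheelGraph n).Adj (some i) (some (i + 1)) := by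
  have : Fact (1 < n) := ⟨by omega⟩
  simp [wheelGraph]

lemma wheel_adj' (i : ZMod n) : (wheelGraph n).Adj (some i) none := by
  simp [wheelGraph]

lemma wheel_cases {u v : Option (ZMod n)} (h : (wheelGraph n).Adj u v) :
    (∃ i, u = some i ∧ v = none) ∨ (∃ i, u = none ∧ v = some i) ∨
    (∃ i, u = some i ∧ v = some (i + 1)) ∨ (∃ i, u = some (i + 1) ∧ v = some i) := by
  rw [wheelGraph, SimpleGraph.fromRel_adj] at h
  obtain ⟨_, (⟨h1, h2⟩ | ⟨i, h1, h2⟩) | (⟨h1, h2⟩ | ⟨i, h1, h2⟩)⟩ := h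
  · obtain ⟨i, hi⟩ := Option.ne_none_iff_exists'.1 h2
    exact Or.inr (Or.inl ⟨i, h1, hi⟩)
  · exact Or.inr (Or.inr (Or.inl ⟨i, h1, h2⟩))
  · obtain ⟨i, hi⟩ := Option.ne_none_iff_exists'.1 h2
    exact Or.inl ⟨i, hi, h1⟩
  · exact Or.inr (Or.inr (Or.inr ⟨i, h2, h1⟩))

lemma pw_dual [NeZero n] (m : ℕ) (y : Option (ZMod n) → ℝ)
    (hy : y ∈ (m : ℝ) • symEdgePolytope (wheelGraph n)) (g : Option (ZMod n) → ℝ) (B : ℝ)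
    (hg : ∀ u v, (wheelGraph n).Adj u v → g u - g v ≤ B) :
    ∑ v, g v * y v ≤ m * B := by
  obtain ⟨z, hz, rfl⟩ := hy
  have hsub : symEdgePolytope (wheelGraph n) ⊆ {z | ∑ v, g v * z v ≤ B} := by
    apply convexHull_min
    · rintro _ ⟨u, v, huv, rfl⟩
      have := hg u v huv
      simpa [mul_sub, Finset.sum_sub_distrib, Pi.single_apply, -Fintype.sum_option] using this
    · apply convex_halfSpace_le
      constructor
      · intro a b; simp only [Pi.add_apply, mul_add, Finset.sum_add_distrib]
      · intro c a; simp only [Pi.smul_apply, smul_eq_mul, Finset.mul_sum]; exact Finset.sum_congr rfl fun _ _ => by ring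
  have h := hsub hz
  change ∑ v, g v * z v ≤ B at h
  calc ∑ v, g v * ((m : ℝ) • z) v = m * ∑ v, g v * z v := by
        simp only [Pi.smul_apply, smul_eq_mul, Finset.mul_sum]; exact Finset.sum_congr rfl fun _ _ => by ring
    _ ≤ m * B := by gcongr

lemma pw_edge {u v : Option (ZMod n)} (h : (wheelGraph n).Adj u v) (c : ℤ) :
    (c : ℝ) • (Pi.single u (1 : ℝ) - Pi.single v 1 : Option (ZMod n) → ℝ) ∈
      |(c : ℝ)| • symEdgePolytope (wheelGraph n) := by
  rcases le_total 0 (c : ℝ) with hc | hc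
  · rw [abs_of_nonneg hc]
    exact Set.smul_mem_smul_set (subset_convexHull ℝ _ ⟨u, v, h, rfl⟩)
  · rw [abs_of_nonpos hc]
    refine ⟨Pi.single v (1 : ℝ) - Pi.single u 1, subset_convexHull ℝ _ ⟨v, u, h.symm, rfl⟩, ?_⟩
    simp only [neg_smul, smul_sub]; abel

lemma sum_mem_smul {E ι : Type*} [AddCommGroup E] [Module ℝ E] (P : Set E) (hP : Convex ℝ P)
    (h0 : (0 : E) ∈ P)
    (t : Finset ι) (c : ι → ℝ) (z : ι → E) (hc : ∀ i, 0 ≤ c i) (hz : ∀ i, z i ∈ c i • P) :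
    ∑ i ∈ t, z i ∈ (∑ i ∈ t, c i) • P := by
  classical
  induction t using Finset.induction_on with
  | empty => exact ⟨0, h0, by simp⟩
  | insert a t ha ih =>
    rw [Finset.sum_insert ha, Finset.sum_insert ha,
      hP.add_smul (hc a) (Finset.sum_nonneg fun i _ => hc i)]
    exact Set.add_mem_add (hz a) ih

lemma pw_mem [NeZero n] (hn : 3 ≤ n) (m : ℕ) (f s : ZMod n → ℤ)
    (h : ∑ i, |f i| + ∑ i, |s i| ≤ m) :
    lft (bd f s) ∈ (m : ℝ) • symEdgePolytope (wheelGraph n) := by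
  set P := symEdgePolytope (wheelGraph n) with hPdef
  have hP : Convex ℝ P := convex_convexHull ℝ _
  have h0 : (0 : Option (ZMod n) → ℝ) ∈ P := by
    have a := subset_convexHull ℝ _ (show _ ∈ {x : Option (ZMod n) → ℝ | ∃ v w, (wheelGraph n).Adj v w ∧
      x = Pi.single v (1 : ℝ) - Pi.single w 1} from ⟨_, _, wheel_adj' 0, rfl⟩)
    have b := subset_convexHull ℝ _ (show _ ∈ {x : Option (ZMod n) → ℝ | ∃ v w, (wheelGraph n).Adj v w ∧
      x = Pi.single v (1 : ℝ) - Pi.single w 1} from ⟨_, _, (wheel_adj' 0).symm, rfl⟩)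
    have := hP a b (a := 1/2) (b := 1/2) (by norm_num) (by norm_num) (by norm_num)
    convert this using 1
    rw [← smul_add]; simp
  have hmono : ∀ r : ℝ, 0 ≤ r → r ≤ m → r • P ⊆ (m : ℝ) • P := by
    intro r hr hrm
    have : (m : ℝ) = r + (m - r) := by ring
    rw [this, hP.add_smul hr (by linarith)]
    intro z hz
    exact ⟨z, hz, 0, ⟨0, h0, by simp⟩, by simp⟩
  have key := sum_mem_smul P hP h0 (Finset.univ : Finset (ZMod n ⊕ ZMod n))
    (Sum.elim (fun i => |(f i : ℝ)|) (fun i => |(s i : ℝ)|))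
    (Sum.elim (fun i => (f i : ℝ) • (Pi.single (some i) (1 : ℝ) - Pi.single (some (i + 1)) 1))
      (fun i => (s i : ℝ) • (Pi.single (some i) (1 : ℝ) - Pi.single none 1)))
    (by rintro (i | i) <;> simp)
    (by rintro (i | i)
        · exact pw_edge (wheel_adj hn i) _
        · exact pw_edge (wheel_adj' i) _)
  have hle : ∑ i, Sum.elim (fun i => |(f i : ℝ)|) (fun i => |(s i : ℝ)|) i ≤ (m : ℝ) := by
    rw [Fintype.sum_sum_type]
    simp only [Sum.elim_inl, Sum.elim_inr]
    exact_mod_cast h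
  have := hmono _ (Finset.sum_nonneg (by rintro (i | i) _ <;> simp)) hle key
  convert this using 1
  rw [Fintype.sum_sum_type]
  simp only [Sum.elim_inl, Sum.elim_inr]
  have e : ∀ i j : ZMod n, (i = j + 1) ↔ (j = i - 1) := fun i j => by
    constructor <;> (rintro rfl; ring)
  funext v
  rcases v with _ | i
  · simp [lft, bd, Finset.sum_apply, Finset.sum_add_distrib, Finset.sum_sub_distrib]
    rw [← Equiv.sum_comp (Equiv.subRight (1 : ZMod n)) (fun i => (f i : ℝ))]
    simp
  · simp [lft, bd, Finset.sum_apply, Pi.single_apply, mul_sub, Finset.sum_sub_distrib, e]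
    ring

lemma lattice_iff [NeZero n] (hn : 3 ≤ n) (m : ℕ) (y : Option (ZMod n) → ℝ) :
    (y ∈ (m : ℝ) • symEdgePolytope (wheelGraph n) ∧ ∀ v, ∃ z : ℤ, y v = z) ↔
    ∃ f s : ZMod n → ℤ, Canon f s ∧ (∃ i, f i = 0 ∨ s i ≠ 0) ∧
      ∑ i, |f i| + ∑ i, |s i| ≤ m ∧ y = lft (bd f s) := by
  constructor
  · rintro ⟨hy, hz⟩
    choose z hz using hz
    obtain ⟨f, s, hx, hc, hD⟩ := exists_canon (fun i => z (some i))
    have h1 := pw_dual m y hy (fun _ => 1) 0 (by simp)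
    have h2 := pw_dual m y hy (fun _ => -1) 0 (by simp)
    have hyl : y = lft (bd f s) := by
      rw [hx]
      funext v
      rcases v with _ | i
      · simp [Fintype.sum_option] at h1 h2
        simp only [lft, ← hz]
        linarith
      · simp [lft, hz]
    refine ⟨f, s, hc, hD, ?_, hyl⟩
    obtain ⟨g, g1, g2, g3⟩ := canon_dual f s hc
    have := pw_dual m y hy (fun v => v.elim 0 (fun i => (g i : ℝ))) 1 (by
      intro u v huv
      rcases wheel_cases huv with ⟨i, rfl, rfl⟩ | ⟨i, rfl, rfl⟩ | ⟨i, rfl, rfl⟩ | ⟨i, rfl, rfl⟩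
      · have := (abs_le.1 (g1 i)).2
        simp; exact_mod_cast this
      · have := (abs_le.1 (g1 i)).1
        simp; have : (-1 : ℝ) ≤ g i := by exact_mod_cast this
        linarith
      · have := (abs_le.1 (g2 i)).2
        simp only [Option.elim]; exact_mod_cast this
      · have := (abs_le.1 (g2 i)).1
        simp only [Option.elim]
        have : (-1 : ℝ) ≤ g i - g (i + 1) := by exact_mod_cast this
        linarith)
    rw [hyl] at this
    simp [Fintype.sum_option, lft] at this
    rw [← g3]
    exact_mod_cast this
  · rintro ⟨f, s, hc, hD, hle, rfl⟩
    refine ⟨pw_mem hn m f s hle, ?_⟩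
    rintro (_ | i)
    · exact ⟨- ∑ i, bd f s i, by simp [lft]⟩
    · exact ⟨bd f s i, by simp [lft]⟩

end poly
section transfer
open Matrix

lemma pow_apply_walk {S : Type*} [Fintype S] [DecidableEq S] (M : Matrix S S ℤ) (k : ℕ) :
    ∀ p r, (M ^ k) p r = ∑ τ : Fin (k + 1) → S, if τ 0 = p ∧ τ (Fin.last k) = r then
      ∏ i : Fin k, M (τ i.castSucc) (τ i.succ) else 0 := by
  induction k with
  | zero =>
    intro p r
    refine Eq.trans ?_ (Equiv.sum_comp (Equiv.funUnique (Fin 1) S).symm _)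
    simp [Matrix.one_apply, ite_and]
  | succ k ih =>
    intro p r
    rw [pow_succ', Matrix.mul_apply]
    simp only [ih, Finset.mul_sum]
    rw [Finset.sum_comm]
    refine Eq.trans ?_ (Equiv.sum_comp (Fin.consEquiv (fun _ : Fin (k + 2) => S)) (fun τ : Fin (k + 2) → S =>
      if τ 0 = p ∧ τ (Fin.last (k + 1)) = r then
      ∏ i : Fin (k + 1), M (τ i.castSucc) (τ i.succ) else 0))
    rw [Fintype.sum_prod_type_right]
    refine Finset.sum_congr rfl fun τ _ => ?_
    simp [Fin.consEquiv, ite_and, Fin.prod_univ_succ, ← Fin.succ_last]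

lemma card_closed {S : Type*} [Fintype S] [DecidableEq S] (Q : S → S → Prop) [DecidableRel Q]
    (n : ℕ) [NeZero n] :
    ((Finset.univ.filter fun σ : ZMod n → S => ∀ i, Q (σ i) (σ (i + 1))).card : ℤ) =
      Matrix.trace ((Matrix.of fun p q => if Q p q then (1 : ℤ) else 0) ^ n) := by
  obtain _ | k := n
  · exact absurd rfl (NeZero.ne 0)
  set M : Matrix S S ℤ := Matrix.of fun p q => if Q p q then (1 : ℤ) else 0 with hM
  have e : Matrix.trace (M ^ (k + 1)) = ∑ τ : Fin (k + 1) → S, ∏ i, M (τ i) (τ (i + 1)) := by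
    rw [pow_succ]
    simp only [Matrix.trace, Matrix.diag, Matrix.mul_apply, pow_apply_walk, Finset.sum_mul]
    rw [Finset.sum_congr rfl fun p _ => Finset.sum_comm]
    rw [Finset.sum_comm]
    refine Finset.sum_congr rfl fun τ _ => ?_
    simp [ite_and, Fin.prod_univ_castSucc, Finset.sum_ite_eq]
  rw [e, Finset.card_filter]
  push_cast
  refine Finset.sum_congr rfl fun τ _ => ?_
  simp only [hM, Matrix.of_apply]
  by_cases h : ∀ i : ZMod (k + 1), Q (τ i) (τ (i + 1))
  · rw [if_pos h]
    exact (Finset.prod_eq_one fun i _ => if_pos (h i)).symm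
  · rw [if_neg h]
    push Not at h
    obtain ⟨i, hi⟩ := h
    exact (Finset.prod_eq_zero (Finset.mem_univ i) (if_neg hi)).symm

/-- weight -/
def wt (p : SignType × SignType) : ℕ := (if p.1 = 0 then 0 else 1) + (if p.2 = 0 then 0 else 1)

/-- zero indicator -/
def zi (p : SignType × SignType) : ℕ := if wt p = 0 then 1 else 0

/-- tight relation -/
def QQ (p q : SignType × SignType) : Prop := RR p q ∧ wt p + zi p = 1 + zi q

instance : DecidableRel QQ := fun p q => by unfold QQ; infer_instance

/-- tight relation without spokes -/
def QD (p q : SignType × SignType) : Prop := QQ p q ∧ p.2 = 0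

instance : DecidableRel QD := fun p q => by unfold QD; infer_instance

lemma RR_wt : ∀ p q, RR p q → wt p + zi p ≤ 1 + zi q := by decide

/-- transfer matrix -/
def MQ : Matrix (SignType × SignType) (SignType × SignType) ℤ := Matrix.of fun p q => if QQ p q then 1 else 0
/-- transfer matrix -/
def MD : Matrix (SignType × SignType) (SignType × SignType) ℤ := Matrix.of fun p q => if QD p q then 1 else 0

lemma MQ_rec : MQ ^ 4 = 2 • MQ ^ 3 + 2 • MQ ^ 2 := by decide +kernel

lemma MD_rec : MD ^ 4 = MD ^ 2 := by decide +kernel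

lemma tr_MQ (k : ℕ) : ((MQ ^ (k + 2)).trace : ℝ) = (1 - √3) ^ (k + 2) + (1 + √3) ^ (k + 2) := by
  have hs : √3 ^ 2 = (3 : ℝ) := Real.sq_sqrt (by norm_num)
  induction k using Nat.twoStepInduction with
  | zero =>
    have : (MQ ^ 2).trace = 8 := by decide +kernel
    simp only [zero_add, this]; push_cast; linarith
  | one =>
    have : (MQ ^ 3).trace = 20 := by decide +kernel
    simp only [Nat.reduceAdd, this]; push_cast; linarith
  | more k h1 h2 =>
    have : MQ ^ (k + 2 + 2) = 2 • MQ ^ (k + 1 + 2) + 2 • MQ ^ (k + 2) := by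
      rw [show k + 2 + 2 = k + 4 by ring, pow_add, MQ_rec, mul_add, mul_smul_comm, mul_smul_comm,
        ← pow_add, ← pow_add]
    rw [this, Matrix.trace_add, Matrix.trace_smul, Matrix.trace_smul]
    push_cast
    simp only [nsmul_eq_mul, Int.cast_mul, Int.cast_natCast]
    push_cast
    rw [h1, h2]
    have e1 : (1 - √3) ^ 2 = 2 * (1 - √3) + 2 := by linarith
    have e2 : (1 + √3) ^ 2 = 2 * (1 + √3) + 2 := by linarith
    rw [pow_add (1 - √3) (k+2) 2, pow_add (1 + √3) (k+2) 2, e1, e2]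
    ring

lemma tr_MD (k : ℕ) : ((MD ^ (k + 2)).trace : ℝ) = 1 + (-1) ^ (k + 2) := by
  induction k using Nat.twoStepInduction with
  | zero =>
    have : (MD ^ 2).trace = 2 := by decide +kernel
    simp only [zero_add, this]; norm_num
  | one =>
    have : (MD ^ 3).trace = 0 := by decide +kernel
    simp only [Nat.reduceAdd, this]; norm_num
  | more k h1 h2 =>
    have : MD ^ (k + 2 + 2) = MD ^ (k + 2) := by
      rw [show k + 2 + 2 = k + 4 by ring, pow_add, MD_rec, ← pow_add]
    rw [this, h1]
    ring

variable {n : ℕ}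

/-- good patterns -/
def good (n : ℕ) [NeZero n] : Finset (ZMod n → SignType × SignType) :=
  Finset.univ.filter fun σ => (∀ i, QQ (σ i) (σ (i + 1))) ∧ ∃ i, (σ i).2 ≠ 0

lemma card_good [NeZero n] (hn : 3 ≤ n) :
    ((good n).card : ℝ) = (1 - √3) ^ n + (1 + √3) ^ n - 1 - (-1) ^ n := by
  have h1 := card_closed QQ n
  have h2 := card_closed QD n
  have h3 : (good n).card + (Finset.univ.filter fun σ : ZMod n → SignType × SignType =>
      ∀ i, QD (σ i) (σ (i + 1))).card = (Finset.univ.filter fun σ : ZMod n → SignType × SignType =>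
      ∀ i, QQ (σ i) (σ (i + 1))).card := by
    rw [← Finset.card_union_of_disjoint]
    · congr 1
      ext σ
      simp only [good, QD, Finset.mem_union, Finset.mem_filter, Finset.mem_univ, true_and, forall_and]
      constructor
      · tauto
      · intro h
        by_cases h' : ∀ i, (σ i).2 = 0
        · exact Or.inr ⟨h, h'⟩
        · push Not at h'; exact Or.inl ⟨h, h'⟩
    · rw [Finset.disjoint_left]
      intro σ
      simp only [good, QD, Finset.mem_filter, Finset.mem_univ, true_and]
      rintro ⟨_, i, hi⟩ h
      exact hi ((Finset.mem_filter.1 h).2 i).2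
  obtain ⟨k, rfl⟩ : ∃ k, n = k + 2 := ⟨n - 2, by omega⟩
  have t1 := tr_MQ k
  have t2 := tr_MD k
  rw [MQ, ← h1] at t1
  rw [MD, ← h2] at t2
  push_cast at t1 t2
  have h3' := congrArg (Nat.cast : ℕ → ℝ) h3
  push_cast at h3'
  linarith

lemma sum_wt [NeZero n] (σ : ZMod n → SignType × SignType) (h : ∀ i, RR (σ i) (σ (i + 1))) :
    ∑ i, wt (σ i) ≤ n ∧ (∑ i, wt (σ i) = n ↔ ∀ i, QQ (σ i) (σ (i + 1))) := by
  have hs : ∑ i, zi (σ (i + 1)) = ∑ i, zi (σ i) :=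
    Equiv.sum_comp (Equiv.addRight (1 : ZMod n)) (fun i => zi (σ i))
  have key : ∀ i ∈ (Finset.univ : Finset (ZMod n)), wt (σ i) + zi (σ i) ≤ 1 + zi (σ (i + 1)) :=
    fun i _ => RR_wt _ _ (h i)
  have h1 := Finset.sum_le_sum key
  have h2 := Finset.sum_eq_sum_iff_of_le key
  simp only [Finset.sum_add_distrib, hs, Finset.sum_const, Finset.card_univ, ZMod.card,
    smul_eq_mul, mul_one, Finset.mem_univ, forall_const] at h1 h2
  refine ⟨by omega, ?_⟩
  rw [show (∑ i, wt (σ i) = n) ↔ (∑ i, wt (σ i) + ∑ i, zi (σ i) = n + ∑ i, zi (σ i)) by omega, h2]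
  simp only [QQ, h, true_and]

end transfer
section counting

lemma card_sign {ι : Type*} [Fintype ι] [DecidableEq ι] (τ : ι → SignType) (m : ℕ) :
    ∃ A : Finset (ι → ℤ), (∀ v, v ∈ A ↔ (∀ i, SignType.sign (v i) = τ i) ∧ ∑ i, |v i| ≤ m) ∧
      A.card = m.choose (Fintype.card {i // τ i ≠ 0}) := by
  classical
  set k := Fintype.card {i // τ i ≠ 0} with hk
  have habs : ∀ v : ι → ℤ, (∀ i, SignType.sign (v i) = τ i) →
      ∑ i, |v i| = ∑ i : {i // τ i ≠ 0}, (|v i| - 1) + k := by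
    intro v hv
    rw [Finset.sum_sub_distrib]
    simp only [Finset.sum_const, Finset.card_univ, ← hk, nsmul_eq_mul, mul_one, sub_add_cancel]
    rw [← Finset.sum_subtype (Finset.univ.filter fun i => τ i ≠ 0) (by simp) (fun i => |v i|)]
    symm
    apply Finset.sum_filter_of_ne
    intro i _ hi h
    rw [← hv, sign_eq_zero_iff] at h
    simp [h] at hi
  have hge : ∀ v : ι → ℤ, (∀ i, SignType.sign (v i) = τ i) → ∀ i : {i // τ i ≠ 0}, 1 ≤ |v i| := by
    intro v hv i
    have := i.2
    rw [← hv, Ne, sign_eq_zero_iff] at this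
    exact Int.one_le_abs this
  by_cases hkm : k ≤ m
  swap
  · refine ⟨∅, fun v => ?_, by rw [Nat.choose_eq_zero_of_lt (by omega)]; rfl⟩
    simp only [Finset.notMem_empty, false_iff]
    rintro ⟨hv, hs⟩
    rw [habs v hv] at hs
    have : 0 ≤ ∑ i : {i // τ i ≠ 0}, (|v i| - 1) :=
      Finset.sum_nonneg fun i _ => by have := hge v hv i; omega
    omega
  let J : (Option {i // τ i ≠ 0} →₀ ℕ) → (ι → ℤ) := fun w i =>
    if h : τ i ≠ 0 then (τ i : ℤ) * (w (some ⟨i, h⟩) + 1) else 0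
  have hJs : ∀ w i, SignType.sign (J w i) = τ i := by
    intro w i
    by_cases h : τ i ≠ 0
    · simp only [J, dif_pos h]
      have : (0 : ℤ) < w (some ⟨i, h⟩) + 1 := by positivity
      rw [sign_mul, sign_pos this]
      rcases τ i <;> simp
    · simp only [J, dif_neg h]
      push Not at h
      simp [h]
  have hJa : ∀ w (i : {i // τ i ≠ 0}), |J w i| = w (some i) + 1 := by
    intro w i
    simp only [J, dif_pos i.2]
    have : (0 : ℤ) < w (some i) + 1 := by positivity
    rw [abs_mul, abs_of_pos this]
    have h2 := i.2
    have : |((τ i : SignType) : ℤ)| = 1 := by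
      revert h2
      generalize τ i = t
      revert t
      decide
    rw [this, one_mul]
  refine ⟨(Finset.finsuppAntidiag Finset.univ (m - k)).image J, fun v => ?_, ?_⟩
  · simp only [Finset.mem_image, Finset.mem_finsuppAntidiag, Finset.subset_univ, and_true]
    constructor
    · rintro ⟨w, hw, rfl⟩
      refine ⟨hJs w, ?_⟩
      rw [habs _ (hJs w)]
      simp only [hJa, add_sub_cancel_right]
      rw [Fintype.sum_option] at hw
      zify [hkm] at hw
      have : (0 : ℤ) ≤ w none := by positivity
      linarith
    · rintro ⟨hv, hs⟩
      have hs' := hs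
      rw [habs v hv] at hs'
      refine ⟨Finsupp.equivFunOnFinite.symm (fun o => o.elim (m - ∑ i, |v i|).toNat
        (fun i => (|v i| - 1).toNat)), ?_, ?_⟩
      · simp only [Fintype.sum_option, Finsupp.equivFunOnFinite_symm_apply_apply, Option.elim]
        zify [hkm]
        rw [Int.toNat_of_nonneg (by omega), habs v hv]
        rw [Finset.sum_congr rfl fun i _ => Int.toNat_of_nonneg (by have := hge v hv i; omega)]
        ring
      · funext i
        by_cases h : τ i ≠ 0
        · have := hge v hv ⟨i, h⟩
          simp only [J, dif_pos h, Finsupp.equivFunOnFinite_symm_apply_apply, Option.elim]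
          rw [Int.toNat_of_nonneg (by simp only at this; omega), ← hv]
          simp [sign_mul_abs]
        · simp only [J, dif_neg h]
          push Not at h
          rw [← hv, sign_eq_zero_iff] at h
          exact h.symm
  · rw [Finset.card_image_of_injOn, Finset.card_finsuppAntidiag_nat_eq_choose]
    · rw [Finset.card_univ, Fintype.card_option, ← hk, show k + 1 + (m - k) - 1 = m by omega]
      exact Nat.choose_symm hkm
    · intro w hw w' hw' hww
      simp only [Finset.mem_coe, Finset.mem_finsuppAntidiag, Finset.subset_univ, and_true,
        Fintype.sum_option] at hw hw'
      have h1 : ∀ i, w (some i) = w' (some i) := by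
        intro i
        have a := hJa w i
        have b := hJa w' i
        rw [hww] at a
        omega
      ext o
      rcases o with _ | i
      · simp only [h1] at hw; omega
      · exact h1 i

variable {n : ℕ}

lemma card_pat [NeZero n] (σ : ZMod n → SignType × SignType) (m : ℕ) :
    ∃ A : Finset ((ZMod n → ℤ) × (ZMod n → ℤ)),
      (∀ v, v ∈ A ↔ (∀ i, (SignType.sign (v.1 i), SignType.sign (v.2 i)) = σ i) ∧
        ∑ i, |v.1 i| + ∑ i, |v.2 i| ≤ m) ∧
      A.card = m.choose (∑ i, wt (σ i)) := by
  obtain ⟨A, h1, h2⟩ := card_sign (Sum.elim (fun i => (σ i).1) (fun i => (σ i).2)) m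
  refine ⟨A.map (Equiv.sumArrowEquivProdArrow _ _ _).toEmbedding, fun v => ?_, ?_⟩
  · rw [Finset.mem_map_equiv, h1]
    simp [Fintype.sum_sum_type, Equiv.sumArrowEquivProdArrow, Prod.ext_iff, forall_and]
  · rw [Finset.card_map, h2]
    congr 1
    rw [Fintype.card_subtype, Finset.card_filter, Fintype.sum_sum_type, ← Finset.sum_add_distrib]
    refine Finset.sum_congr rfl fun i _ => ?_
    simp only [wt, Sum.elim_inl, Sum.elim_inr]
    clear h1 h2
    by_cases ha : (σ i).1 = 0 <;> by_cases hb : (σ i).2 = 0 <;> simp [ha, hb]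

lemma count_bounds [NeZero n] (hn : 3 ≤ n) (m : ℕ) :
    (good n).card * m.choose n ≤ latticePointCount (symEdgePolytope (wheelGraph n)) m ∧
    latticePointCount (symEdgePolytope (wheelGraph n)) m ≤ (good n).card * m.choose n +
      ∑ σ ∈ Finset.univ.filter (fun σ : ZMod n → SignType × SignType => ∑ i, wt (σ i) < n),
        m.choose (∑ i, wt (σ i)) := by
  classical
  choose A hA hcard using fun σ : ZMod n → SignType × SignType => card_pat σ m
  set π : (ZMod n → ℤ) × (ZMod n → ℤ) → Option (ZMod n) → ℝ := fun v => lft (bd v.1 v.2) with hπ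
  set X : Set (Option (ZMod n) → ℝ) := {x | x ∈ (m : ℝ) • symEdgePolytope (wheelGraph n) ∧
    ∀ v, ∃ z : ℤ, x v = z} with hX
  have hcount : latticePointCount (symEdgePolytope (wheelGraph n)) m = X.ncard := rfl
  set low := Finset.univ.filter (fun σ : ZMod n → SignType × SignType => ∑ i, wt (σ i) < n) with hlow
  have hgc : ∀ σ ∈ good n, (A σ).card = m.choose n := by
    intro σ hσ
    simp only [good, Finset.mem_filter, Finset.mem_univ, true_and] at hσ
    rw [hcard, ((sum_wt σ (fun i => (hσ.1 i).1)).2).2 hσ.1]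
  have hup : X ⊆ (((good n ∪ low).biUnion A).image π : Finset _) := by
    intro y hy
    obtain ⟨f, s, hc, hD, hle, rfl⟩ := (lattice_iff hn m y).1 hy
    rw [Finset.mem_coe, Finset.mem_image]
    refine ⟨(f, s), ?_, rfl⟩
    rw [Finset.mem_biUnion]
    refine ⟨fun i => (SignType.sign (f i), SignType.sign (s i)), ?_, (hA _ _).2 ⟨fun i => rfl, hle⟩⟩
    rw [Finset.mem_union]
    obtain ⟨w1, w2⟩ := sum_wt (fun i => (SignType.sign (f i), SignType.sign (s i))) hc
    rcases w1.lt_or_eq with h | h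
    · exact Or.inr (by simpa [hlow] using h)
    · refine Or.inl ?_
      simp only [good, Finset.mem_filter, Finset.mem_univ, true_and]
      have hq := w2.1 h
      refine ⟨hq, ?_⟩
      by_contra hno
      push Not at hno
      have hle1 : ∀ i ∈ (Finset.univ : Finset (ZMod n)),
          wt (SignType.sign (f i), SignType.sign (s i)) ≤ 1 := by
        intro i _
        have := hno i
        simp only [wt, this]
        split_ifs <;> simp
      have h' : ∑ i, wt (SignType.sign (f i), SignType.sign (s i)) = ∑ i : ZMod n, 1 := by
        rw [h]; simp
      have hall := (Finset.sum_eq_sum_iff_of_le hle1).1 h'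
      obtain ⟨i, hi⟩ := hD
      have h0 := hno i
      have h1 := hall i (Finset.mem_univ _)
      simp only [sign_eq_zero_iff] at h0
      simp only [wt, sign_eq_zero_iff, h0, if_true] at h1
      rcases hi with hi | hi
      · simp [hi] at h1
      · exact hi h0
  have hlo : (((good n).biUnion A).image π : Set _) ⊆ X := by
    intro y hy
    obtain ⟨⟨f, s⟩, hv, rfl⟩ := Finset.mem_image.1 (Finset.mem_coe.1 hy)
    obtain ⟨σ, hσ, hv⟩ := Finset.mem_biUnion.1 hv
    obtain ⟨h1, h2⟩ := (hA _ _).1 hv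
    simp only [good, Finset.mem_filter, Finset.mem_univ, true_and] at hσ
    refine (lattice_iff hn m _).2 ⟨f, s, ?_, ?_, h2, rfl⟩
    · intro i
      have a := h1 i
      have b := h1 (i + 1)
      simp only at a b
      rw [a, b]
      exact (hσ.1 i).1
    · obtain ⟨i, hi⟩ := hσ.2
      refine ⟨i, Or.inr ?_⟩
      rw [← h1 i] at hi
      simpa using hi
  have hinj : Set.InjOn π ((good n).biUnion A) := by
    rintro ⟨f, s⟩ hv ⟨f', s'⟩ hv' h
    obtain ⟨σ, hσ, hv⟩ := Finset.mem_biUnion.1 hv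
    obtain ⟨σ', hσ', hv'⟩ := Finset.mem_biUnion.1 hv'
    obtain ⟨h1, h2⟩ := (hA _ _).1 hv
    obtain ⟨h1', h2'⟩ := (hA _ _).1 hv'
    simp only [good, Finset.mem_filter, Finset.mem_univ, true_and] at hσ hσ'
    have hbd := lft_inj h
    have := canon_inj f s f' s' (fun i => by
      have a := h1 i
      have b := h1 (i + 1)
      simp only at a b
      rw [a, b]
      exact (hσ.1 i).1) (fun i => by
      have a := h1' i
      have b := h1' (i + 1)
      simp only at a b
      rw [a, b]
      exact (hσ'.1 i).1) hbd (by
      obtain ⟨i, hi⟩ := hσ.2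
      refine ⟨i, ?_⟩
      rw [← h1 i] at hi
      simpa using hi)
    rw [this.1, this.2]
  have hfin : X.Finite := (Finset.finite_toSet _).subset hup
  constructor
  · rw [hcount]
    calc (good n).card * m.choose n = ((good n).biUnion A).card := by
          rw [Finset.card_biUnion, Finset.sum_congr rfl hgc]
          · simp
          · intro σ _ σ' _ hne
            rw [Function.onFun, Finset.disjoint_left]
            intro v hv hv'
            apply hne
            funext i
            rw [← ((hA _ _).1 hv).1 i, ← ((hA _ _).1 hv').1 i]
      _ = (((good n).biUnion A).image π).card := (Finset.card_image_of_injOn hinj).symm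
      _ = ((((good n).biUnion A).image π : Finset _) : Set _).ncard := (Set.ncard_coe_finset _).symm
      _ ≤ X.ncard := Set.ncard_le_ncard (by simpa using hlo) hfin
  · rw [hcount]
    calc X.ncard ≤ _ := Set.ncard_le_ncard hup (Finset.finite_toSet _)
      _ = _ := Set.ncard_coe_finset _
      _ ≤ ((good n ∪ low).biUnion A).card := Finset.card_image_le
      _ ≤ ((good n).biUnion A).card + (low.biUnion A).card := by
          rw [Finset.union_biUnion]; exact Finset.card_union_le _ _
      _ ≤ ∑ σ ∈ good n, (A σ).card + ∑ σ ∈ low, (A σ).card :=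
          add_le_add Finset.card_biUnion_le Finset.card_biUnion_le
      _ = _ := by
          rw [Finset.sum_congr rfl hgc]
          simp [hcard]

lemma choose_lim (k : ℕ) : Filter.Tendsto (fun m : ℕ => (m.choose k : ℝ) / (m : ℝ) ^ k) Filter.atTop
    (nhds (1 / (k.factorial : ℝ))) := by
  have h := ProbabilityTheory.tendsto_choose_mul_pow_atTop (p := fun m : ℕ => (m : ℝ)⁻¹) (r := 1) k (by
    refine tendsto_const_nhds.congr' ?_
    filter_upwards [Filter.eventually_gt_atTop 0] with m hm
    have : (m : ℝ) ≠ 0 := by positivity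
    field_simp)
  simpa [div_eq_mul_inv] using h

lemma choose_lim0 (k n : ℕ) (h : k < n) :
    Filter.Tendsto (fun m : ℕ => (m.choose k : ℝ) / (m : ℝ) ^ n) Filter.atTop (nhds 0) := by
  have h1 : Filter.Tendsto (fun m : ℕ => (((m : ℝ)) ^ (n - k))⁻¹) Filter.atTop (nhds 0) :=
    tendsto_inv_atTop_zero.comp ((Filter.tendsto_pow_atTop (by omega)).comp tendsto_natCast_atTop_atTop)
  have := (choose_lim k).mul h1
  rw [mul_zero] at this
  refine this.congr fun m => ?_
  rw [← div_eq_mul_inv, div_div, ← pow_add, Nat.add_sub_cancel' h.le]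

end counting
/-- For `n ≥ 3`, the Ehrhart counting function of the symmetric edge
polytope of the wheel graph `W = K1 * C_n` satisfies
`lim_{m→∞} #(m·P_W ∩ ℤ^{n+1}) / m^n = ((1−√3)^n + (1+√3)^n − 1 − (−1)^n)/n!`,
i.e. the normalized volume of `P_W` is `(1−√3)^n + (1+√3)^n` for odd `n` and
`(1−√3)^n + (1+√3)^n − 2` for even `n`. -/
theorem stmt15 (n : ℕ) (hn : 3 ≤ n) :
    Filter.Tendsto
      (fun m : ℕ =>
        (latticePointCount (symEdgePolytope (wheelGraph n)) m : ℝ) / (m : ℝ) ^ n)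
      Filter.atTop
      (nhds (((1 - Real.sqrt 3) ^ n + (1 + Real.sqrt 3) ^ n - 1 - (-1 : ℝ) ^ n) /
        (Nat.factorial n : ℝ))) := by
  have : NeZero n := ⟨by omega⟩
  rw [← card_good hn]
  have hg : Filter.Tendsto (fun m : ℕ => ((good n).card : ℝ) * ((m.choose n : ℝ) / (m : ℝ) ^ n))
      Filter.atTop (nhds (((good n).card : ℝ) / (n.factorial : ℝ))) := by
    have := (choose_lim n).const_mul ((good n).card : ℝ)
    rwa [mul_one_div] at this
  have hl : Filter.Tendsto (fun m : ℕ =>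
      ∑ σ ∈ Finset.univ.filter (fun σ : ZMod n → SignType × SignType => ∑ i, wt (σ i) < n),
        (m.choose (∑ i, wt (σ i)) : ℝ) / (m : ℝ) ^ n) Filter.atTop (nhds 0) := by
    rw [← Finset.sum_const_zero]
    exact tendsto_finsetSum _ fun σ hσ => choose_lim0 _ _ (Finset.mem_filter.1 hσ).2
  have hu := hg.add hl
  rw [add_zero] at hu
  refine tendsto_of_tendsto_of_tendsto_of_le_of_le hg hu (fun m => ?_) (fun m => ?_)
  · have := (count_bounds hn m).1
    dsimp only
    rw [← mul_div_assoc]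
    gcongr
    exact_mod_cast this
  · have := (count_bounds hn m).2
    dsimp only
    rw [← mul_div_assoc, ← Finset.sum_div, ← add_div]
    gcongr
    exact_mod_cast this
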